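/- arXiv:1712.08030 — 4 statements merged into one kernel-verified Lean document; each statement's English description precedes it below -/
import Mathlib

section
/- Let k ≥ l ≥ 1 be integers, n = k + l, m = k − l (so n > m ≥ 0). Set c₂ = 1/(4(n+2)(n+1)), c₁ = −1/(2n(n+2)), c₀ = 1/(4n(n+1)). Then the function F : ℝ² → ℂ given by F = c₂ V^m_{n+2} + c₁ V^m_n + c₀ V^m_{n−2}, where V^m_{n+2} and V^m_{n−2} are the Zernike functions with derivative orders (l+1, k+1) and (l−1, k−1) respectively, satisfies ΔF = V^m_n on all of ℝ² (where Δ = ∂²/∂x² + ∂²/∂y² acts on real and imaginary parts), and F(x,y) = 0 whenever x² + y² = 1. -/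
open MvPolynomial

/-- `𝒫_n(z,w) = (zw − 1)^n / n!` as a polynomial in two commuting variables
(`X 0` is `z`, `X 1` is `w`). -/
noncomputable def Zpol (n : ℕ) : MvPolynomial (Fin 2) ℂ :=
  C (1 / (n.factorial : ℂ)) * (X 0 * X 1 - 1) ^ n

/-- Formal partial differentiation `∂_z`. -/
noncomputable def dz (p : MvPolynomial (Fin 2) ℂ) : MvPolynomial (Fin 2) ℂ :=
  pderiv (0 : Fin 2) p

/-- Formal partial differentiation `∂_w`. -/
noncomputable def dw (p : MvPolynomial (Fin 2) ℂ) : MvPolynomial (Fin 2) ℂ :=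
  pderiv (1 : Fin 2) p

/-- The Zernike polynomial `𝒱^m_n = ∂_z^l ∂_w^k 𝒫_n` with derivative orders
`(l, k)`, where `n = k + l` and `m = k − l`. -/
noncomputable def ZernikePoly (k l : ℕ) : MvPolynomial (Fin 2) ℂ :=
  dz^[l] (dw^[k] (Zpol (k + l)))

/-- The Zernike function `V^m_n(x,y) = 𝒱^m_n(x + iy, x − iy)`. -/
noncomputable def ZernikeFun (k l : ℕ) (p : ℝ × ℝ) : ℂ :=
  eval (fun i => if i = 0 then (p.1 : ℂ) + p.2 * Complex.I
                 else (p.1 : ℂ) - p.2 * Complex.I) (ZernikePoly k l)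

/-- The Laplacean `ΔF = ∂²F/∂x² + ∂²F/∂y²` of a complex-valued function on
`ℝ²` (acting on real and imaginary parts). -/
noncomputable def lapC (F : ℝ × ℝ → ℂ) (p : ℝ × ℝ) : ℂ :=
  deriv (fun x => deriv (fun x' => F (x', p.2)) x) p.1 +
  deriv (fun y => deriv (fun y' => F (p.1, y')) y) p.2

theorem dz_dw_comm (p : MvPolynomial (Fin 2) ℂ) : dz (dw p) = dw (dz p) := by
  have h : ⁅(pderiv 0 : Derivation ℂ (MvPolynomial (Fin 2) ℂ) _),
      (pderiv (1 : Fin 2) : Derivation ℂ (MvPolynomial (Fin 2) ℂ) _)⁆ = 0 := by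
    refine MvPolynomial.derivation_ext fun i => ?_
    fin_cases i <;> simp [Derivation.commutator_apply, pderiv_X]
  have h' := DFunLike.congr_fun h p
  rw [Derivation.commutator_apply] at h'
  exact sub_eq_zero.mp h'

theorem iterate_dz_add (j : ℕ) (p q : MvPolynomial (Fin 2) ℂ) :
    dz^[j] (p + q) = dz^[j] p + dz^[j] q :=
  Function.Semiconj₂.iterate (f := dz) (op := (· + ·)) (map_add (pderiv 0)) j p q

theorem iterate_dw_add (j : ℕ) (p q : MvPolynomial (Fin 2) ℂ) :
    dw^[j] (p + q) = dw^[j] p + dw^[j] q :=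
  Function.Semiconj₂.iterate (f := dw) (op := (· + ·)) (map_add (pderiv 1)) j p q

theorem dz_C_mul (a : ℂ) (p : MvPolynomial (Fin 2) ℂ) : dz (C a * p) = C a * dz p :=
  pderiv_C_mul

theorem dw_C_mul (a : ℂ) (p : MvPolynomial (Fin 2) ℂ) : dw (C a * p) = C a * dw p :=
  pderiv_C_mul

theorem iterate_dz_C_mul (j : ℕ) (a : ℂ) (p : MvPolynomial (Fin 2) ℂ) :
    dz^[j] (C a * p) = C a * dz^[j] p :=
  Function.Commute.iterate_left (f := dz) (g := fun q => C a * q) (dz_C_mul a) j p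

theorem iterate_dw_C_mul (j : ℕ) (a : ℂ) (p : MvPolynomial (Fin 2) ℂ) :
    dw^[j] (C a * p) = C a * dw^[j] p :=
  Function.Commute.iterate_left (f := dw) (g := fun q => C a * q) (dw_C_mul a) j p

theorem iterate_dw_dz (j : ℕ) (p : MvPolynomial (Fin 2) ℂ) : dw^[j] (dz p) = dz (dw^[j] p) :=
  Function.Commute.iterate_left (f := dw) (g := dz) (fun q => (dz_dw_comm q).symm) j p

theorem iterate_dz_dw (j : ℕ) (p : MvPolynomial (Fin 2) ℂ) : dz^[j] (dw p) = dw (dz^[j] p) :=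
  Function.Commute.iterate_left (f := dz) (g := dw) dz_dw_comm j p

/-- `∂_z ∂_w` pulled out of a mixed derivative. -/
theorem iterate_succ_dz_dw (k l : ℕ) (p : MvPolynomial (Fin 2) ℂ) :
    dz^[l + 1] (dw^[k + 1] p) = dz^[l] (dw^[k] (dz (dw p))) := by
  rw [Function.iterate_succ_apply, Function.iterate_succ_apply, iterate_dw_dz]

theorem iterate_succ_dz_dw' (k l : ℕ) (p : MvPolynomial (Fin 2) ℂ) :
    dz^[l + 1] (dw^[k + 1] p) = dz (dw (dz^[l] (dw^[k] p))) := by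
  rw [Function.iterate_succ_apply', Function.iterate_succ_apply', iterate_dz_dw]

theorem C_succ_mul_C_inv_factorial (n : ℕ) :
    C ((n : ℂ) + 1) * C (1 / ((n + 1).factorial : ℂ)) =
      (C (1 / (n.factorial : ℂ)) : MvPolynomial (Fin 2) ℂ) := by
  rw [← C_mul]
  congr 1
  have : (n : ℂ) + 1 ≠ 0 := by exact_mod_cast n.succ_ne_zero
  have : (n.factorial : ℂ) ≠ 0 := by exact_mod_cast n.factorial_ne_zero
  rw [Nat.factorial_succ]
  push_cast
  field_simp

theorem dz_Zpol_succ (n : ℕ) : dz (Zpol (n + 1)) = X 1 * Zpol n := by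
  have h : C (1 / ((n + 1).factorial : ℂ)) * ((n : MvPolynomial (Fin 2) ℂ) + 1) =
      C (1 / (n.factorial : ℂ)) := by
    rw [← C_succ_mul_C_inv_factorial n, C_add, C_1, map_natCast, mul_comm]
  simp only [dz, Zpol, pderiv_C_mul, pderiv_pow, ← h]
  simp [pderiv_X]
  ring

theorem dw_Zpol_succ (n : ℕ) : dw (Zpol (n + 1)) = X 0 * Zpol n := by
  have h : C (1 / ((n + 1).factorial : ℂ)) * ((n : MvPolynomial (Fin 2) ℂ) + 1) =
      C (1 / (n.factorial : ℂ)) := by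
    rw [← C_succ_mul_C_inv_factorial n, C_add, C_1, map_natCast, mul_comm]
  simp only [dw, Zpol, pderiv_C_mul, pderiv_pow, ← h]
  simp [pderiv_X]
  ring

theorem X_mul_X_mul_Zpol (n : ℕ) :
    X 0 * X 1 * Zpol n = C ((n : ℂ) + 1) * Zpol (n + 1) + Zpol n := by
  simp only [Zpol]
  rw [← mul_assoc (C _), C_succ_mul_C_inv_factorial]
  ring

theorem dz_dw_Zpol (n : ℕ) :
    dz (dw (Zpol (n + 2))) = C ((n : ℂ) + 2) * Zpol (n + 1) + Zpol n := by
  have hX : dz (X 0 * Zpol (n + 1)) = Zpol (n + 1) + X 0 * dz (Zpol (n + 1)) := by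
    simp [dz, pderiv_X, add_comm]
  rw [dw_Zpol_succ, hX, dz_Zpol_succ, ← mul_assoc, X_mul_X_mul_Zpol,
    show (n : ℂ) + 2 = (n + 1) + 1 by ring, C_add (a := (n : ℂ) + 1), C_1]
  ring

/-- Cancellation of the lower-order terms in `c₂ (∂_z ∂_w)² 𝒫_{n+2} + c₁ ∂_z ∂_w 𝒫_n + c₀ 𝒫_{n-2}`,
where `n = j + 2`. -/
theorem Zpol_combination (j : ℕ) :
    C (1 / (4 * ((j : ℂ) + 2 + 2) * ((j : ℂ) + 2 + 1))) * dz (dw (dz (dw (Zpol (j + 4))))) +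
      C (-1 / (2 * ((j : ℂ) + 2) * ((j : ℂ) + 2 + 2))) * dz (dw (Zpol (j + 2))) +
      C (1 / (4 * ((j : ℂ) + 2) * ((j : ℂ) + 2 + 1))) * Zpol j = C (1 / 4) * Zpol (j + 2) := by
  have hadd (p q) : dz (dw (p + q)) = dz (dw p) + dz (dw q) := by simp [dz, dw]
  have h2 : (j : ℂ) + 2 ≠ 0 := by exact_mod_cast (j + 1).succ_ne_zero
  have h3 : (j : ℂ) + 2 + 1 ≠ 0 := by exact_mod_cast (j + 2).succ_ne_zero
  have h4 : (j : ℂ) + 2 + 2 ≠ 0 := by exact_mod_cast (j + 3).succ_ne_zero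
  rw [dz_dw_Zpol (j + 2), hadd, dw_C_mul, dz_C_mul, dz_dw_Zpol (j + 1), dz_dw_Zpol j]
  push_cast
  simp only [← smul_eq_C_mul]
  match_scalars <;> field_simp <;> ring

theorem dvd_pderiv_of_pow_succ_dvd {σ R : Type*} [CommSemiring R] (i : σ)
    {u p : MvPolynomial σ R} {m : ℕ} (h : u ^ (m + 1) ∣ p) : u ^ m ∣ pderiv i p := by
  obtain ⟨q, rfl⟩ := h
  rw [pderiv_mul, pderiv_pow, Nat.add_sub_cancel]
  exact dvd_add (((dvd_mul_left _ _).mul_right _).mul_right _)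
    ((pow_dvd_pow u m.le_succ).mul_right _)

theorem pow_dvd_iterate_pderiv {σ R : Type*} [CommSemiring R] (i : σ)
    {u : MvPolynomial σ R} {m : ℕ} (j : ℕ) {p : MvPolynomial σ R} (h : u ^ (m + j) ∣ p) :
    u ^ m ∣ (pderiv i)^[j] p := by
  induction j generalizing p with
  | zero => exact h
  | succ j ih => exact ih (dvd_pderiv_of_pow_succ_dvd i h)

/-- The point `(x + iy, x − iy)`. -/
noncomputable def conjPair (x y : ℝ) : Fin 2 → ℂ :=
  fun i => if i = 0 then (x : ℂ) + y * Complex.I else (x : ℂ) - y * Complex.I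

theorem hasDerivAt_eval_conjPair_left (P : MvPolynomial (Fin 2) ℂ) (x y : ℝ) :
    HasDerivAt (fun t : ℝ => eval (conjPair t y) P) (eval (conjPair x y) (dz P + dw P)) x := by
  induction P using MvPolynomial.induction_on with
  | C a => simpa [dz, dw] using hasDerivAt_const x a
  | add p q hp hq =>
    simp only [map_add]
    refine (hp.add hq).congr_deriv ?_
    simp only [dz, dw, map_add]
    ring
  | mul_X p i hp =>
    have hX : HasDerivAt (fun t : ℝ => conjPair t y i) 1 x := by
      have h := Complex.ofRealCLM.hasDerivAt (x := x)
      fin_cases i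
      · simpa [conjPair] using h.add_const ((y : ℂ) * Complex.I)
      · simpa [conjPair] using h.sub_const ((y : ℂ) * Complex.I)
    simp only [map_mul, eval_X]
    refine (hp.mul hX).congr_deriv ?_
    fin_cases i <;> simp [dz, dw, pderiv_X] <;> ring

theorem hasDerivAt_eval_conjPair_right (P : MvPolynomial (Fin 2) ℂ) (x y : ℝ) :
    HasDerivAt (fun t : ℝ => eval (conjPair x t) P)
      (eval (conjPair x y) (C Complex.I * (dz P - dw P))) y := by
  induction P using MvPolynomial.induction_on with
  | C a => simpa [dz, dw] using hasDerivAt_const y a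
  | add p q hp hq =>
    simp only [map_add]
    refine (hp.add hq).congr_deriv ?_
    simp only [dz, dw, map_add, map_sub, map_mul]
    ring
  | mul_X p i hp =>
    have hX : HasDerivAt (fun t : ℝ => conjPair x t i)
        (if i = 0 then Complex.I else -Complex.I) y := by
      have h := (Complex.ofRealCLM.hasDerivAt (x := y)).mul_const Complex.I
      fin_cases i
      · simpa [conjPair] using h.const_add (x : ℂ)
      · simpa [conjPair] using h.const_sub (x : ℂ)
    simp only [map_mul, eval_X]
    refine (hp.mul hX).congr_deriv ?_
    fin_cases i <;> simp [dz, dw, pderiv_X] <;> ring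

/-- In the variables `z = x + iy`, `w = x − iy` the Laplacean is `4 ∂_z ∂_w`. -/
theorem lapC_eval_conjPair (P : MvPolynomial (Fin 2) ℂ) (p : ℝ × ℝ) :
    lapC (fun q => eval (conjPair q.1 q.2) P) p = eval (conjPair p.1 p.2) (C 4 * dz (dw P)) := by
  simp only [lapC, (hasDerivAt_eval_conjPair_left _ _ _).deriv,
    (hasDerivAt_eval_conjPair_right _ _ _).deriv]
  rw [dz_C_mul, dw_C_mul]
  have hdz : dz (dz P + dw P) = dz (dz P) + dz (dw P) := map_add (pderiv 0) _ _
  have hdw : dw (dz P + dw P) = dz (dw P) + dw (dw P) := by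
    rw [dz_dw_comm]; exact map_add (pderiv 1) _ _
  have hdz' : dz (dz P - dw P) = dz (dz P) - dz (dw P) := map_sub (pderiv 0) _ _
  have hdw' : dw (dz P - dw P) = dz (dw P) - dw (dw P) := by
    rw [dz_dw_comm]; exact map_sub (pderiv 1) _ _
  rw [hdz, hdw, hdz', hdw']
  simp only [map_add, map_sub, map_mul, eval_C]
  linear_combination (eval (conjPair p.1 p.2) (dz (dz P)) -
    2 * eval (conjPair p.1 p.2) (dz (dw P)) + eval (conjPair p.1 p.2) (dw (dw P))) * Complex.I_mul_I

/-- The combination defining the inverse Laplacean is `¼ ∂_z^{l-1} ∂_w^{k-1} 𝒫_n`. -/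
theorem ZernikePoly_combination (k l : ℕ) :
    C (1 / (4 * (((k + l : ℕ) : ℂ) + 2 + 2) * (((k + l : ℕ) : ℂ) + 2 + 1))) *
        ZernikePoly (k + 2) (l + 2) +
      C (-1 / (2 * (((k + l : ℕ) : ℂ) + 2) * (((k + l : ℕ) : ℂ) + 2 + 2))) *
        ZernikePoly (k + 1) (l + 1) +
      C (1 / (4 * (((k + l : ℕ) : ℂ) + 2) * (((k + l : ℕ) : ℂ) + 2 + 1))) * ZernikePoly k l =
    C (1 / 4) * dz^[l] (dw^[k] (Zpol (k + l + 2))) := by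
  simp only [ZernikePoly, show k + 2 + (l + 2) = k + l + 4 by ring,
    show k + 1 + (l + 1) = k + l + 2 by ring, iterate_succ_dz_dw,
    ← iterate_dz_C_mul, ← iterate_dw_C_mul, ← iterate_dz_add, ← iterate_dw_add, Zpol_combination]

theorem eval_conjPair_iterate_Zpol (k l : ℕ) {x y : ℝ} (h : x ^ 2 + y ^ 2 = 1) :
    eval (conjPair x y) (dz^[l] (dw^[k] (Zpol (k + l + 2)))) = 0 := by
  have hdvd : (X 0 * X 1 - 1 : MvPolynomial (Fin 2) ℂ) ^ 2 ∣
      dz^[l] (dw^[k] (Zpol (k + l + 2))) := by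
    refine pow_dvd_iterate_pderiv 0 l (pow_dvd_iterate_pderiv 1 k ?_)
    rw [show 2 + l + k = k + l + 2 by ring]
    exact dvd_mul_left _ _
  obtain ⟨q, hq⟩ := hdvd
  have hc : (x : ℂ) ^ 2 + (y : ℂ) ^ 2 = 1 := by exact_mod_cast h
  have h0 : ((x : ℂ) + y * Complex.I) * (x - y * Complex.I) - 1 = 0 := by
    linear_combination hc - (y : ℂ) ^ 2 * Complex.I_sq
  rw [hq]
  simp [conjPair, h0]

/-- The inverse Dirichlet Laplacean of a Zernike function `V^m_n` with
`n > m ≥ 0`: the combination `c₂ V^m_{n+2} + c₁ V^m_n + c₀ V^m_{n−2}` has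
Laplacean `V^m_n` and vanishes on the unit circle. -/
theorem invLap_zernike (k l : ℕ) (hl : 1 ≤ l) (hlk : l ≤ k) :
    let n : ℕ := k + l
    let c₂ : ℂ := 1 / (4 * ((n : ℂ) + 2) * ((n : ℂ) + 1))
    let c₁ : ℂ := -1 / (2 * (n : ℂ) * ((n : ℂ) + 2))
    let c₀ : ℂ := 1 / (4 * (n : ℂ) * ((n : ℂ) + 1))
    let F : ℝ × ℝ → ℂ := fun p =>
      c₂ * ZernikeFun (k + 1) (l + 1) p + c₁ * ZernikeFun k l p +
        c₀ * ZernikeFun (k - 1) (l - 1) p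
    (∀ p : ℝ × ℝ, lapC F p = ZernikeFun k l p) ∧
    (∀ p : ℝ × ℝ, p.1 ^ 2 + p.2 ^ 2 = 1 → F p = 0) := by
  obtain ⟨l, rfl⟩ := Nat.exists_eq_add_of_le' hl
  obtain ⟨k, rfl⟩ := Nat.exists_eq_add_of_le' (hl.trans hlk)
  intro n c₂ c₁ c₀ F
  have hn : (n : ℂ) = ((k + l : ℕ) : ℂ) + 2 := by simp only [n]; push_cast; ring
  have hF : F = fun p => eval (conjPair p.1 p.2)
      (C (1 / 4) * dz^[l] (dw^[k] (Zpol (k + l + 2)))) := by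
    funext p
    rw [← ZernikePoly_combination]
    simp only [map_add, map_mul, eval_C, F, c₂, c₁, c₀, hn]
    rfl
  rw [hF]
  refine ⟨fun p => ?_, fun p hp => ?_⟩
  · rw [lapC_eval_conjPair, dw_C_mul, dz_C_mul, ← mul_assoc, ← C_mul, ← iterate_succ_dz_dw',
      show (4 : ℂ) * (1 / 4) = 1 by norm_num, C_1, one_mul,
      show k + l + 2 = k + 1 + (l + 1) by ring]
    rfl
  · dsimp only
    rw [map_mul, eval_conjPair_iterate_Zpol k l hp, mul_zero]
end

section
/- Let m ≥ 0 be an integer and set c₂ = 1/(4(m+2)(m+1)). Then the function F : ℝ² → ℂ given by F = c₂ (V^m_{m+2} − V^m_m), where V^m_m and V^m_{m+2} are the Zernike functions with derivative orders (0, m) and (1, m+1) respectively, satisfies ΔF = V^m_m on all of ℝ² (where Δ = ∂²/∂x² + ∂²/∂y² acts on real and imaginary parts), and F(x,y) = 0 whenever x² + y² = 1. -/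
open MvPolynomial

theorem dw_X_zero_pow_mul (k : ℕ) (p : MvPolynomial (Fin 2) ℂ) :
    dw (X 0 ^ k * p) = X 0 ^ k * dw p := by
  simp [dw]

theorem dw_iterate_Zpol (n k : ℕ) : dw^[k] (Zpol (n + k)) = X 0 ^ k * Zpol n := by
  induction k generalizing n with
  | zero => simp
  | succ k ih =>
    rw [Function.iterate_succ_apply', show n + (k + 1) = (n + 1) + k by ring, ih,
      dw_X_zero_pow_mul, dw_Zpol_succ]
    ring

theorem ZernikePoly_zero_right (m : ℕ) : ZernikePoly m 0 = X 0 ^ m := by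
  have h := dw_iterate_Zpol 0 m
  rw [zero_add] at h
  rw [ZernikePoly, add_zero, h]
  simp [Zpol]

theorem ZernikePoly_succ_one (m : ℕ) :
    ZernikePoly (m + 1) 1 = C ((m : ℂ) + 2) * (X 0 ^ (m + 1) * X 1) - C ((m : ℂ) + 1) * X 0 ^ m := by
  have h := dw_iterate_Zpol 1 (m + 1)
  rw [add_comm 1 (m + 1)] at h
  have h2 : (C 2 : MvPolynomial (Fin 2) ℂ) = 2 := map_ofNat C 2
  rw [ZernikePoly, h]
  simp [Zpol, dz, h2]
  ring

theorem ZernikeFun_zero_right (m : ℕ) (p : ℝ × ℝ) :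
    ZernikeFun m 0 p = ((p.1 : ℂ) + p.2 * Complex.I) ^ m := by
  simp [ZernikeFun, ZernikePoly_zero_right]

theorem ZernikeFun_succ_one_sub (m : ℕ) (p : ℝ × ℝ) :
    ZernikeFun (m + 1) 1 p - ZernikeFun m 0 p =
      ((m : ℂ) + 2) * (((p.1 : ℂ) + p.2 * Complex.I) ^ (m + 1) * ((p.1 : ℂ) - p.2 * Complex.I) -
        ((p.1 : ℂ) + p.2 * Complex.I) ^ m) := by
  simp [ZernikeFun, ZernikePoly_zero_right, ZernikePoly_succ_one]
  ring

theorem hasDerivAt_add_ofReal_mul (a b : ℂ) (t : ℝ) :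
    HasDerivAt (fun s : ℝ => a + (s : ℂ) * b) b t := by
  simpa using ((Complex.ofRealCLM.hasDerivAt (x := t)).mul_const b).const_add a

theorem hasDerivAt_add_ofReal_mul_pow (a b : ℂ) (n : ℕ) (t : ℝ) :
    HasDerivAt (fun s : ℝ => (a + (s : ℂ) * b) ^ n) (n * (a + (t : ℂ) * b) ^ (n - 1) * b) t :=
  (hasDerivAt_add_ofReal_mul a b t).pow n

/-- Second derivative of `c (z^(m+1) w - z^m)` along a real line on which `z` and `w` are affine. -/
theorem deriv_deriv_pow_succ_mul_sub_pow (a b a' b' c : ℂ) (m : ℕ) (t : ℝ) :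
    deriv (fun u : ℝ => deriv (fun s : ℝ =>
      c * ((a + (s : ℂ) * b) ^ (m + 1) * (a' + (s : ℂ) * b') - (a + (s : ℂ) * b) ^ m)) u) t =
    c * (b ^ 2 * ((m + 1) * m * (a + (t : ℂ) * b) ^ (m - 1) * (a' + (t : ℂ) * b') -
      m * (m - 1 : ℕ) * (a + (t : ℂ) * b) ^ (m - 1 - 1)) +
      2 * b * b' * (m + 1) * (a + (t : ℂ) * b) ^ m) := by
  have h1 : ∀ u : ℝ, deriv (fun s : ℝ =>
      c * ((a + (s : ℂ) * b) ^ (m + 1) * (a' + (s : ℂ) * b') - (a + (s : ℂ) * b) ^ m)) u =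
      c * (((m + 1 : ℕ) : ℂ) * (a + (u : ℂ) * b) ^ m * b * (a' + (u : ℂ) * b') +
        (a + (u : ℂ) * b) ^ (m + 1) * b' - m * (a + (u : ℂ) * b) ^ (m - 1) * b) := fun u =>
    ((((hasDerivAt_add_ofReal_mul_pow a b (m + 1) u).mul
      (hasDerivAt_add_ofReal_mul a' b' u)).sub
      (hasDerivAt_add_ofReal_mul_pow a b m u)).const_mul c).deriv
  simp only [h1]
  refine (((((((hasDerivAt_add_ofReal_mul_pow a b m t).const_mul ((m + 1 : ℕ) : ℂ)).mul_const
    b).mul (hasDerivAt_add_ofReal_mul a' b' t)).add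
    ((hasDerivAt_add_ofReal_mul_pow a b (m + 1) t).mul_const b')).sub
    (((hasDerivAt_add_ofReal_mul_pow a b (m - 1) t).const_mul (m : ℂ)).mul_const
    b)).const_mul c).deriv.trans ?_
  rw [Nat.add_sub_cancel]
  push_cast
  ring

/-- The inverse Dirichlet Laplacean of a Zernike function `V^m_m` with
`m ≥ 0`: the combination `c₂ (V^m_{m+2} − V^m_m)` has Laplacean `V^m_m` and
vanishes on the unit circle. -/
theorem invLap_zernike_diag (m : ℕ) :
    let c₂ : ℂ := 1 / (4 * ((m : ℂ) + 2) * ((m : ℂ) + 1))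
    let F : ℝ × ℝ → ℂ := fun p =>
      c₂ * (ZernikeFun (m + 1) 1 p - ZernikeFun m 0 p)
    (∀ p : ℝ × ℝ, lapC F p = ZernikeFun m 0 p) ∧
    (∀ p : ℝ × ℝ, p.1 ^ 2 + p.2 ^ 2 = 1 → F p = 0) := by
  intro c₂ F
  have hm1 : (m : ℂ) + 1 ≠ 0 := by exact_mod_cast m.succ_ne_zero
  have hm2 : (m : ℂ) + 2 ≠ 0 := by exact_mod_cast (m + 1).succ_ne_zero
  have hF : ∀ p, F p = c₂ * ((m : ℂ) + 2) *
      (((p.1 : ℂ) + p.2 * Complex.I) ^ (m + 1) * ((p.1 : ℂ) - p.2 * Complex.I) -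
        ((p.1 : ℂ) + p.2 * Complex.I) ^ m) := fun p => by
    simp only [F, ZernikeFun_succ_one_sub, mul_assoc]
  refine ⟨fun ⟨x, y⟩ => ?_, fun ⟨x, y⟩ h => ?_⟩
  · have hx : ∀ s : ℝ, F (s, y) = c₂ * ((m : ℂ) + 2) *
        ((y * Complex.I + s * 1) ^ (m + 1) * (-(y * Complex.I) + s * 1) -
          (y * Complex.I + s * 1) ^ m) := fun s => by
      rw [hF]
      ring
    have hy : ∀ s : ℝ, F (x, s) = c₂ * ((m : ℂ) + 2) *
        ((x + s * Complex.I) ^ (m + 1) * (x + s * -Complex.I) -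
          (x + s * Complex.I) ^ m) := fun s => by
      rw [hF]
      ring
    have hc : c₂ * ((m : ℂ) + 2) * (4 * (m + 1)) = 1 := by
      simp only [c₂]
      field_simp
    have hI : Complex.I * -Complex.I = 1 := by simp
    simp only [lapC, hx, hy, deriv_deriv_pow_succ_mul_sub_pow, ZernikeFun_zero_right,
      Complex.I_sq, mul_assoc 2 Complex.I, hI]
    rw [show (y : ℂ) * Complex.I + x * 1 = x + y * Complex.I by ring]
    linear_combination ((x : ℂ) + y * Complex.I) ^ m * hc
  · have h' : (x : ℂ) ^ 2 + (y : ℂ) ^ 2 = 1 := by exact_mod_cast h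
    rw [hF]
    linear_combination c₂ * ((m : ℂ) + 2) * ((x : ℂ) + y * Complex.I) ^ m *
      (h' - (y : ℂ) ^ 2 * Complex.I_sq)
end

section
/- For every integer n ≥ 2, setting c₂ = 1/(4(n+2)(n+1)), c₁ = −1/(2n(n+2)), and c₀ = 1/(4n(n+1)), the polynomial identity c₂ (∂_z ∂_w)² 𝒫_{n+2} + c₁ (∂_z ∂_w) 𝒫_n + c₀ 𝒫_{n−2} = (1/4) 𝒫_n holds in ℂ[z,w]. -/
open MvPolynomial

theorem C_mul_inv_factorial_succ {σ : Type*} (n : ℕ) :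
    (C (1 / ((n + 1).factorial : ℂ)) : MvPolynomial σ ℂ) * C ((n : ℂ) + 1) =
      C (1 / (n.factorial : ℂ)) := by
  rw [← C_mul]
  congr 1
  have := n.cast_add_one_ne_zero (R := ℂ)
  have := (Nat.cast_ne_zero (R := ℂ)).mpr n.factorial_ne_zero
  rw [Nat.factorial_succ]
  push_cast
  field_simp

theorem pderiv_Zpol_succ (i : Fin 2) (n : ℕ) :
    pderiv i (Zpol (n + 1)) = pderiv i (X 0 * X 1) * Zpol n := by
  rw [Zpol, Zpol, ← C_mul_inv_factorial_succ n, pderiv_C_mul, Derivation.leibniz_pow, map_sub,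
    pderiv_one, sub_zero, smul_eq_mul, nsmul_eq_mul, Nat.add_sub_cancel, C_add, C_1]
  simp only [map_natCast]
  push_cast
  ring

theorem dz_dw_add (p q : MvPolynomial (Fin 2) ℂ) :
    dz (dw (p + q)) = dz (dw p) + dz (dw q) := by
  simp [dz, dw]

theorem dz_dw_C_mul (a : ℂ) (p : MvPolynomial (Fin 2) ℂ) :
    dz (dw (C a * p)) = C a * dz (dw p) := by
  simp only [dz, dw, pderiv_C_mul]

/-- For `n ≥ 2`:
`c₂ (∂_z∂_w)² 𝒫_{n+2} + c₁ (∂_z∂_w) 𝒫_n + c₀ 𝒫_{n−2} = (1/4) 𝒫_n`. -/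
theorem preInvLap_Zpol (n : ℕ) (hn : 2 ≤ n) :
    let c₂ : ℂ := 1 / (4 * ((n : ℂ) + 2) * ((n : ℂ) + 1))
    let c₁ : ℂ := -1 / (2 * (n : ℂ) * ((n : ℂ) + 2))
    let c₀ : ℂ := 1 / (4 * (n : ℂ) * ((n : ℂ) + 1))
    C c₂ * dz (dw (dz (dw (Zpol (n + 2))))) + C c₁ * dz (dw (Zpol n)) +
      C c₀ * Zpol (n - 2) = C (1 / 4 : ℂ) * Zpol n := by
  obtain ⟨m, rfl⟩ := Nat.exists_eq_add_of_le' hn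
  intro c₂ c₁ c₀
  have h₂ : (m : ℂ) + 2 ≠ 0 := by exact_mod_cast (m + 1).succ_ne_zero
  have h₃ : (m : ℂ) + 2 + 1 ≠ 0 := by exact_mod_cast (m + 2).succ_ne_zero
  have h₄ : (m : ℂ) + 2 + 2 ≠ 0 := by exact_mod_cast (m + 3).succ_ne_zero
  have hP : c₂ * (((m : ℂ) + 4) * (m + 3)) = 1 / 4 := by
    simp only [c₂]; push_cast; field_simp; ring
  have hQ : c₂ * (((m : ℂ) + 4) + (m + 2)) + c₁ * (m + 2) = 0 := by
    simp only [c₂, c₁]; push_cast; field_simp; ring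
  have hR : c₂ + c₁ + c₀ = 0 := by
    simp only [c₂, c₁, c₀]; push_cast; field_simp; ring
  have e₄ : dz (dw (Zpol (m + 2 + 2))) = C ((m : ℂ) + 4) * Zpol (m + 3) + Zpol (m + 2) := by
    rw [dz_dw_Zpol]; push_cast; congr 3; ring
  have e₃ : dz (dw (Zpol (m + 3))) = C ((m : ℂ) + 3) * Zpol (m + 2) + Zpol (m + 1) := by
    rw [dz_dw_Zpol (m + 1)]; push_cast; congr 3; ring
  rw [e₄, dz_dw_add, dz_dw_C_mul, e₃, dz_dw_Zpol, Nat.add_sub_cancel, ← hP]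
  have hQ' := congrArg (C (σ := Fin 2)) hQ
  have hR' := congrArg (C (σ := Fin 2)) hR
  simp only [C_add, C_mul, C_0] at hQ' hR' ⊢
  linear_combination Zpol (m + 1) * hQ' + Zpol m * hR'
end

section
/- Let X be a real Banach space, G : X → X Fréchet differentiable, ū ∈ X, M : X → X a bounded linear operator; set A = I − M and 𝒩(h) = G(ū + Ah) − ū + Mh. Suppose there exist δ > 0, ε ≥ 0, K ≥ 0 with ε + Kδ < δ, ‖𝒩(0)‖ ≤ ε, and ‖D𝒩(h)‖ ≤ K for all ‖h‖ ≤ δ. Let S : X → X be a linear isometry satisfying G(Sx) = S(G(x)) for all x ∈ X, S ū = ū, and S∘M = M∘S. Then there exists u* ∈ X with G(u*) = u*, ‖u* − ū‖ ≤ ‖A‖·δ, and S u* = u*. -/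
/-- A self-map of a Banach space that is Lipschitz with constant `K` on the closed ball of radius
`δ` around `0`, and moves `0` by at most `ε`, where `ε + K * δ < δ`, has exactly one fixed point in
that ball. -/
theorem existsUnique_fixedPoint_of_norm_sub_le
    {X : Type*} [NormedAddCommGroup X] [CompleteSpace X] {f : X → X} {δ ε K : ℝ}
    (hδ : 0 < δ) (hε : 0 ≤ ε) (hK : 0 ≤ K) (hcontr : ε + K * δ < δ) (hf0 : ‖f 0‖ ≤ ε)
    (hf : ∀ x y, ‖x‖ ≤ δ → ‖y‖ ≤ δ → ‖f y - f x‖ ≤ K * ‖y - x‖) :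
    ∃! h : X, ‖h‖ ≤ δ ∧ f h = h := by
  have hK1 : K < 1 := by
    by_contra! h
    nlinarith
  have hmaps : Set.MapsTo f (Metric.closedBall 0 δ) (Metric.closedBall 0 δ) := by
    intro x hx
    rw [mem_closedBall_zero_iff] at hx ⊢
    have h1 := hf 0 x (by simpa using hδ.le) hx
    rw [sub_zero] at h1
    have h2 : K * ‖x‖ ≤ K * δ := by gcongr
    linarith [norm_sub_norm_le (f x) (f 0)]
  have hcw : ContractingWith ⟨K, hK⟩ (hmaps.restrict f _ _) := by
    refine ⟨hK1, LipschitzWith.of_dist_le_mul fun x y => ?_⟩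
    rw [Subtype.dist_eq, Subtype.dist_eq, dist_eq_norm, dist_eq_norm]
    exact hf y x (mem_closedBall_zero_iff.1 y.2) (mem_closedBall_zero_iff.1 x.2)
  obtain ⟨h, hmem, hfix, -⟩ := hcw.exists_fixedPoint' Metric.isClosed_closedBall.isComplete hmaps
    (Metric.mem_closedBall_self hδ.le) (edist_ne_top _ _)
  rw [mem_closedBall_zero_iff] at hmem
  refine ⟨h, ⟨hmem, hfix⟩, fun y ⟨hy, hfy⟩ => ?_⟩
  have h1 := hf h y hmem hy
  rw [hfy, hfix.eq] at h1
  have h2 : ‖y - h‖ = 0 := le_antisymm (by nlinarith) (norm_nonneg _)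
  exact sub_eq_zero.1 (norm_eq_zero.1 h2)

/-- Symmetry version of the Newton-type contraction lemma: under the same
contraction hypotheses, if a linear isometry `S` commutes with `G` and `M`
and fixes `ū`, then the fixed point `u*` of `G` obtained within distance
`‖A‖ δ` of `ū` can be chosen invariant under `S`. -/
theorem newton_contraction_symmetric_fixed_point
    {X : Type*} [NormedAddCommGroup X] [NormedSpace ℝ X] [CompleteSpace X]
    (G : X → X) (hG : Differentiable ℝ G) (ubar : X) (M : X →L[ℝ] X)
    (A : X →L[ℝ] X) (hA : A = ContinuousLinearMap.id ℝ X - M)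
    (N : X → X) (hN : ∀ h, N h = G (ubar + A h) - ubar + M h)
    (δ ε K : ℝ) (hδ : 0 < δ) (hε : 0 ≤ ε) (hK : 0 ≤ K)
    (hcontr : ε + K * δ < δ)
    (hN0 : ‖N 0‖ ≤ ε)
    (hDN : ∀ h : X, ‖h‖ ≤ δ → ‖fderiv ℝ N h‖ ≤ K)
    (S : X →ₗᵢ[ℝ] X)
    (hGS : ∀ x : X, G (S x) = S (G x))
    (hSu : S ubar = ubar)
    (hSM : ∀ x : X, S (M x) = M (S x)) :
    ∃ u : X, G u = u ∧ ‖u - ubar‖ ≤ ‖A‖ * δ ∧ S u = u := by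
  have hAx : ∀ x, A x = x - M x := fun x => by simp [hA]
  have hSA : ∀ x, S (A x) = A (S x) := fun x => by rw [hAx, hAx, map_sub, hSM]
  have hNS : ∀ x, N (S x) = S (N x) := fun x => by
    rw [hN, hN, map_add, map_sub, ← hGS, map_add, hSu, hSM, hSA]
  have hNdiff : Differentiable ℝ N := by
    rw [funext hN]
    fun_prop
  have hlip : ∀ x y, ‖x‖ ≤ δ → ‖y‖ ≤ δ → ‖N y - N x‖ ≤ K * ‖y - x‖ := fun x y hx hy =>
    (convex_closedBall (0 : X) δ).norm_image_sub_le_of_norm_fderiv_le (𝕜 := ℝ)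
      (fun z _ => hNdiff z) (fun z hz => hDN z (mem_closedBall_zero_iff.1 hz))
      (mem_closedBall_zero_iff.2 hx) (mem_closedBall_zero_iff.2 hy)
  obtain ⟨h, ⟨hh, hfix⟩, huniq⟩ :=
    existsUnique_fixedPoint_of_norm_sub_le hδ hε hK hcontr hN0 hlip
  have hSh : S h = h := huniq (S h) ⟨by rwa [S.norm_map], by rw [hNS, hfix]⟩
  refine ⟨ubar + A h, ?_, ?_, ?_⟩
  · have h1 := hN h
    rw [hfix] at h1
    calc G (ubar + A h) = ubar + ((G (ubar + A h) - ubar + M h) - M h) := by abel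
      _ = ubar + A h := by rw [← h1, hAx]
  · rw [add_sub_cancel_left]
    exact A.le_opNorm_of_le hh
  · rw [map_add, hSu, hSA, hSh]
end
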